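/- Let n = 2 and let W ∈ C¹(ℝᵐ;ℝ), m ≥ 1, be nonnegative with W(u) > 0 for all u ≠ a and W(a) = 0 for some a ∈ ℝᵐ. Let u ∈ C²(ℝ²;ℝᵐ) be a bounded, globally minimizing solution of Δu = ∇W(u) on ℝ². Then for every δ > 0 there exists R₀ ≥ 1 such that for every R ≥ R₀ there exists S_R ∈ (R, 2R) with max_{|x| = S_R} |u(x) − a| ≤ δ. -/

import Mathlib

open MeasureTheory Metric Filter RealInnerProductSpace

/-- Squared Frobenius norm of the gradient: `|∇u|² = Σᵢ |u_{xᵢ}|²`. -/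
noncomputable def gradSq {n m : ℕ}
    (u : EuclideanSpace ℝ (Fin n) → EuclideanSpace ℝ (Fin m))
    (x : EuclideanSpace ℝ (Fin n)) : ℝ :=
  ∑ i : Fin n, ‖fderiv ℝ u x (EuclideanSpace.single i 1)‖ ^ 2

/-- The Laplacian of `u`, computed componentwise: `Δu = Σᵢ u_{xᵢxᵢ}`. -/
noncomputable def vlap {n m : ℕ}
    (u : EuclideanSpace ℝ (Fin n) → EuclideanSpace ℝ (Fin m))
    (x : EuclideanSpace ℝ (Fin n)) : EuclideanSpace ℝ (Fin m) :=
  ∑ i : Fin n,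
    fderiv ℝ (fun y => fderiv ℝ u y (EuclideanSpace.single i 1)) x (EuclideanSpace.single i 1)

/-- The Allen–Cahn energy `E(u;Ω) = ∫_Ω ((1/2)|∇u|² + W(u)) dx`. -/
noncomputable def energy {n m : ℕ} (W : EuclideanSpace ℝ (Fin m) → ℝ)
    (u : EuclideanSpace ℝ (Fin n) → EuclideanSpace ℝ (Fin m))
    (Ω : Set (EuclideanSpace ℝ (Fin n))) : ℝ :=
  ∫ x in Ω, ((1 / 2) * gradSq u x + W (u x))

/-- `u` is a globally minimizing solution: for every bounded domain `Ω` and every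
perturbation `φ ∈ W^{1,2}_0(Ω;ℝᵐ) ∩ L^∞(Ω;ℝᵐ)` (encoded as a Lipschitz, hence
bounded and `W^{1,2}`, function supported in `Ω`), `E(u;Ω) ≤ E(u+φ;Ω)`. -/
def GloballyMinimizing {n m : ℕ} (W : EuclideanSpace ℝ (Fin m) → ℝ)
    (u : EuclideanSpace ℝ (Fin n) → EuclideanSpace ℝ (Fin m)) : Prop :=
  ∀ Ω : Set (EuclideanSpace ℝ (Fin n)), IsOpen Ω → Bornology.IsBounded Ω →
    ∀ φ : EuclideanSpace ℝ (Fin n) → EuclideanSpace ℝ (Fin m),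
      (∃ K : NNReal, LipschitzWith K φ) → tsupport φ ⊆ Ω →
      energy W u Ω ≤ energy W (u + φ) Ω

lemma exists_lip_smoothTransition : ∃ L : NNReal, LipschitzWith L Real.smoothTransition := by
  have hc : ContDiff ℝ 1 Real.smoothTransition := Real.smoothTransition.contDiff
  have hcd : Continuous (deriv Real.smoothTransition) := hc.continuous_deriv le_rfl
  obtain ⟨C, hC⟩ := (isCompact_Icc (a := (0:ℝ)) (b := 1)).exists_bound_of_continuousOn
    hcd.continuousOn
  have hC0 : 0 ≤ C := (norm_nonneg _).trans (hC 0 (by simp))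
  lift C to NNReal using hC0
  have hC0 : 0 ≤ (C : ℝ) := C.2
  refine ⟨C, lipschitzWith_of_nnnorm_deriv_le (hc.differentiable one_ne_zero) fun x => ?_⟩
  rw [← NNReal.coe_le_coe, coe_nnnorm]
  by_cases h0 : x < 0
  · have : Real.smoothTransition =ᶠ[nhds x] fun _ => 0 := by
      filter_upwards [Iio_mem_nhds h0] with y hy
      exact Real.smoothTransition.zero_of_nonpos (le_of_lt hy)
    rw [this.deriv_eq]; simp
  by_cases h1 : 1 < x
  · have : Real.smoothTransition =ᶠ[nhds x] fun _ => 1 := by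
      filter_upwards [Ioi_mem_nhds h1] with y hy
      exact Real.smoothTransition.one_of_one_le (le_of_lt hy)
    rw [this.deriv_eq]; simp
  exact hC x ⟨not_lt.1 h0, not_lt.1 h1⟩

/-- the cutoff function -/
noncomputable def cutoff (ρ : ℝ) (x : EuclideanSpace ℝ (Fin 2)) : ℝ :=
  Real.smoothTransition (1 - 2 * (‖x‖ - ρ))

lemma cutoff_eq_one {ρ : ℝ} {x : EuclideanSpace ℝ (Fin 2)} (h : ‖x‖ ≤ ρ) : cutoff ρ x = 1 :=
  Real.smoothTransition.one_of_one_le (by linarith)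

lemma cutoff_eq_zero {ρ : ℝ} {x : EuclideanSpace ℝ (Fin 2)} (h : ρ + 1 / 2 ≤ ‖x‖) :
    cutoff ρ x = 0 :=
  Real.smoothTransition.zero_of_nonpos (by linarith)

lemma cutoff_eventually_one {ρ : ℝ} {x : EuclideanSpace ℝ (Fin 2)} (h : ‖x‖ < ρ) :
    cutoff ρ =ᶠ[nhds x] fun _ => 1 := by
  have : {y : EuclideanSpace ℝ (Fin 2) | ‖y‖ < ρ} ∈ nhds x :=
    (isOpen_lt continuous_norm continuous_const).mem_nhds h
  filter_upwards [this] with y hy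
  exact cutoff_eq_one (le_of_lt hy)

lemma cutoff_contDiff {ρ : ℝ} (hρ : 0 < ρ) : ContDiff ℝ 2 (cutoff ρ) := by
  rw [contDiff_iff_contDiffAt]
  intro x
  by_cases h : x = 0
  · subst h
    exact contDiffAt_const.congr_of_eventuallyEq (cutoff_eventually_one (by simpa using hρ))
  · have h1 : ContDiffAt ℝ 2 (fun y : EuclideanSpace ℝ (Fin 2) => 1 - 2 * (‖y‖ - ρ)) x :=
      contDiffAt_const.sub (contDiffAt_const.mul ((contDiffAt_norm ℝ h).sub contDiffAt_const))
    exact (Real.smoothTransition.contDiffAt (n := 2)).comp x h1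

lemma cutoff_lip {L : NNReal} (hL : LipschitzWith L Real.smoothTransition) (ρ : ℝ) :
    LipschitzWith (L * 2) (cutoff ρ) := by
  have h : LipschitzWith 2 (fun y : EuclideanSpace ℝ (Fin 2) => 1 - 2 * (‖y‖ - ρ)) := by
    refine LipschitzWith.of_dist_le_mul fun x y => ?_
    rw [Real.dist_eq, dist_eq_norm]
    have h1 := abs_norm_sub_norm_le x y
    have : (1 - 2 * (‖x‖ - ρ) - (1 - 2 * (‖y‖ - ρ))) = -2 * (‖x‖ - ‖y‖) := by ring
    rw [this, abs_mul]
    simpa using h1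
  exact hL.comp h

lemma cut_alg (η p q d : ℝ) (h0 : 0 ≤ η) (h1 : η ≤ 1) :
    ((1 - η ^ 2) * p + 2 * η * q * d) ^ 2 ≤ (1 - η ^ 2 / 2) * p ^ 2 + 12 * q ^ 2 * d ^ 2 := by
  have hs : η ^ 2 ≤ 1 := by nlinarith
  have a1 : 4 * (1 - η ^ 2) * (η * p) * (q * d)
      ≤ (1 - η ^ 2) * (η ^ 2 * p ^ 2 / 2 + 8 * (q * d) ^ 2) := by
    nlinarith [mul_nonneg (sub_nonneg.2 hs) (sq_nonneg (η * p - 4 * (q * d)))]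
  have a2 : 0 ≤ η ^ 2 * (η ^ 2 * p ^ 2 / 2 + 4 * (q * d) ^ 2) := by positivity
  have a3 : 0 ≤ (1 - η ^ 2) * (η ^ 2 * p ^ 2) := mul_nonneg (sub_nonneg.2 hs) (by positivity)
  nlinarith [mul_nonneg (sub_nonneg.2 hs) (sq_nonneg (q * d))]

lemma gradSq_cut {m : ℕ} (u : EuclideanSpace ℝ (Fin 2) → EuclideanSpace ℝ (Fin m))
    (a : EuclideanSpace ℝ (Fin m)) (η : EuclideanSpace ℝ (Fin 2) → ℝ)
    (x : EuclideanSpace ℝ (Fin 2))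
    (hu : DifferentiableAt ℝ u x) (hη : DifferentiableAt ℝ η x) (K : ℝ)
    (hK : ‖fderiv ℝ η x‖ ≤ K) (h0 : 0 ≤ η x) (h1 : η x ≤ 1) :
    gradSq (u + fun y => (η y) ^ 2 • (a - u y)) x
      ≤ (1 - η x ^ 2 / 2) * gradSq u x + 24 * K ^ 2 * ‖a - u x‖ ^ 2 := by
  have hd : HasFDerivAt (u + fun y => (η y) ^ 2 • (a - u y))
      (fderiv ℝ u x + ((η x ^ 2) • (-fderiv ℝ u x) +
        ((2 * η x) • fderiv ℝ η x).smulRight (a - u x))) x := by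
    have e1 : HasFDerivAt (fun y => η y ^ 2) ((2 * η x) • fderiv ℝ η x) x := by
      simpa using hη.hasFDerivAt.pow 2
    exact hu.hasFDerivAt.add (e1.smul (hu.hasFDerivAt.const_sub a))
  have key : ∀ i : Fin 2, ‖fderiv ℝ (u + fun y => (η y) ^ 2 • (a - u y)) x
      (EuclideanSpace.single i 1)‖ ^ 2 ≤ (1 - η x ^ 2 / 2) *
        ‖fderiv ℝ u x (EuclideanSpace.single i 1)‖ ^ 2 + 12 * K ^ 2 * ‖a - u x‖ ^ 2 := by
    intro i
    rw [hd.fderiv]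
    set e : EuclideanSpace ℝ (Fin 2) := EuclideanSpace.single i 1 with he
    have hen : ‖e‖ = 1 := by simp [he]
    have hq : ‖fderiv ℝ η x e‖ ≤ K := by
      have := (fderiv ℝ η x).le_opNorm e
      rw [hen, mul_one] at this
      exact this.trans hK
    have hs : 0 ≤ 1 - η x ^ 2 := by nlinarith
    have hv : (fderiv ℝ u x + ((η x ^ 2) • (-fderiv ℝ u x) +
        ((2 * η x) • fderiv ℝ η x).smulRight (a - u x))) e
        = (1 - η x ^ 2) • fderiv ℝ u x e + (2 * η x * fderiv ℝ η x e) • (a - u x) := by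
      simp [sub_smul]
      abel
    have hn : ‖(1 - η x ^ 2) • fderiv ℝ u x e + (2 * η x * fderiv ℝ η x e) • (a - u x)‖
        ≤ (1 - η x ^ 2) * ‖fderiv ℝ u x e‖ + 2 * η x * K * ‖a - u x‖ := by
      refine (norm_add_le _ _).trans ?_
      rw [norm_smul, norm_smul, Real.norm_of_nonneg hs, norm_mul, norm_mul,
        Real.norm_of_nonneg h0, Real.norm_two]
      gcongr
    rw [hv]
    calc _ ≤ ((1 - η x ^ 2) * ‖fderiv ℝ u x e‖ + 2 * η x * K * ‖a - u x‖) ^ 2 := by gcongr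
      _ ≤ _ := cut_alg _ _ _ _ h0 h1
  unfold gradSq
  rw [Fin.sum_univ_two, Fin.sum_univ_two]
  have := key 0
  have := key 1
  linarith

lemma gradSq_nonneg {n m : ℕ} (u : EuclideanSpace ℝ (Fin n) → EuclideanSpace ℝ (Fin m)) (x) :
    0 ≤ gradSq u x := Finset.sum_nonneg fun _ _ => by positivity

lemma gradSq_continuous {n m : ℕ} (u : EuclideanSpace ℝ (Fin n) → EuclideanSpace ℝ (Fin m))
    (hu : ContDiff ℝ 2 u) : Continuous (gradSq u) := by
  unfold gradSq
  have : Continuous (fderiv ℝ u) := hu.continuous_fderiv (by norm_num)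
  fun_prop

/-- energy density -/
noncomputable def edens {m : ℕ} (W : EuclideanSpace ℝ (Fin m) → ℝ)
    (u : EuclideanSpace ℝ (Fin 2) → EuclideanSpace ℝ (Fin m))
    (x : EuclideanSpace ℝ (Fin 2)) : ℝ := (1 / 2) * gradSq u x + W (u x)

lemma edens_continuous {m : ℕ} (W : EuclideanSpace ℝ (Fin m) → ℝ) (hW : Continuous W)
    (u : EuclideanSpace ℝ (Fin 2) → EuclideanSpace ℝ (Fin m)) (hu : ContDiff ℝ 2 u) :
    Continuous (edens W u) :=
  (continuous_const.mul (gradSq_continuous u hu)).add (hW.comp hu.continuous)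

lemma cont_int_ball {f : EuclideanSpace ℝ (Fin 2) → ℝ} (hf : Continuous f) (r : ℝ) :
    IntegrableOn f (ball 0 r) :=
  (hf.continuousOn.integrableOn_compact (isCompact_closedBall 0 r)).mono_set ball_subset_closedBall

lemma ring_vol {ρ : ℝ} (hρ : 0 ≤ ρ) :
    volume.real (ball (0 : EuclideanSpace ℝ (Fin 2)) (ρ + 1) \ ball 0 ρ)
      = Real.pi * (2 * ρ + 1) := by
  have hb : ∀ r : ℝ, 0 ≤ r → volume.real (ball (0 : EuclideanSpace ℝ (Fin 2)) r)
      = r ^ 2 * Real.pi := by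
    intro r hr
    rw [Measure.real, EuclideanSpace.volume_ball_fin_two, ENNReal.toReal_mul, ENNReal.toReal_pow,
      ENNReal.toReal_ofReal hr, ENNReal.toReal_ofReal Real.pi_pos.le]
  rw [measureReal_sdiff (ball_subset_ball (by linarith)) measurableSet_ball
    measure_ball_lt_top.ne, hb _ hρ, hb _ (by linarith)]
  ring

lemma basic_ineq {m : ℕ}
    (W : EuclideanSpace ℝ (Fin m) → ℝ) (hW : Continuous W)
    (a : EuclideanSpace ℝ (Fin m))
    (hWa : W a = 0) (hW0 : ∀ v, 0 ≤ W v)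
    (u : EuclideanSpace ℝ (Fin 2) → EuclideanSpace ℝ (Fin m))
    (hu : ContDiff ℝ 2 u) (hmin : GloballyMinimizing W u)
    (L : NNReal) (hL : LipschitzWith L Real.smoothTransition)
    (α β : ℝ) (hβ : 0 ≤ β)
    (hαβ : ∀ x, ∀ t ∈ Set.Icc (0:ℝ) 1,
      48 * (L:ℝ) ^ 2 * ‖a - u x‖ ^ 2 + W (u x + t • (a - u x)) ≤ α + β * W (u x))
    (ρ : ℝ) (hρ : 0 < ρ) :
    (1 / 2) * (∫ x in ball 0 ρ, edens W u x) ≤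
      β * ((∫ x in ball 0 (ρ + 1), edens W u x) - ∫ x in ball 0 ρ, edens W u x)
        + α * (Real.pi * (2 * ρ + 1)) := by
  set φ : EuclideanSpace ℝ (Fin 2) → EuclideanSpace ℝ (Fin m) :=
    fun y => (cutoff ρ y) ^ 2 • (a - u y) with hφ
  have hφc : ContDiff ℝ 2 φ := ((cutoff_contDiff hρ).pow 2).smul (contDiff_const.sub hu)
  have hts : tsupport φ ⊆ closedBall 0 (ρ + 1 / 2) := by
    refine closure_minimal (fun x hx => ?_) isClosed_closedBall
    rw [mem_closedBall_zero_iff]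
    by_contra h
    apply hx
    simp [hφ, cutoff_eq_zero (not_le.1 h).le]
  have hcs : HasCompactSupport φ :=
    (isCompact_closedBall _ _).of_isClosed_subset (isClosed_tsupport φ) hts
  have hm := hmin (ball 0 (ρ + 1)) isOpen_ball isBounded_ball φ
    (hφc.lipschitzWith_of_hasCompactSupport hcs (by norm_num))
    (hts.trans (closedBall_subset_ball (by linarith)))
  have hec := edens_continuous W hW u hu
  have hev := edens_continuous W hW (u + φ) (hu.add hφc)
  change (∫ x in ball 0 (ρ + 1), edens W u x) ≤ ∫ x in ball 0 (ρ + 1), edens W (u + φ) x at hm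
  have hsub : ball (0 : EuclideanSpace ℝ (Fin 2)) ρ ⊆ ball 0 (ρ + 1) :=
    ball_subset_ball (by linarith)
  have s1 : ∀ {f : EuclideanSpace ℝ (Fin 2) → ℝ}, Continuous f →
      ∫ x in ball 0 (ρ + 1) \ ball 0 ρ, f x
        = (∫ x in ball 0 (ρ + 1), f x) - ∫ x in ball 0 ρ, f x := fun hf =>
    setIntegral_sdiff measurableSet_ball (cont_int_ball hf _) hsub
  have cut0 : ∀ x, 0 ≤ cutoff ρ x := fun x => Real.smoothTransition.nonneg _
  have cut1 : ∀ x, cutoff ρ x ≤ 1 := fun x => Real.smoothTransition.le_one _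
  have hud : Differentiable ℝ u := hu.differentiable (by norm_num)
  have hcd : Differentiable ℝ (cutoff ρ) := (cutoff_contDiff hρ).differentiable (by norm_num)
  have i1 : (∫ x in ball 0 ρ, edens W (u + φ) x) ≤ ∫ x in ball 0 ρ, (1 / 2) * edens W u x := by
    refine setIntegral_mono_on (cont_int_ball hev _) (cont_int_ball (continuous_const.mul hec) _)
      measurableSet_ball fun x hx => ?_
    rw [mem_ball_zero_iff] at hx
    have hg := gradSq_cut u a (cutoff ρ) x (hud x) (hcd x) 0
      (by rw [(cutoff_eventually_one hx).fderiv_eq]; simp) (cut0 x) (cut1 x)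
    have hc1 := cutoff_eq_one hx.le
    have hWv : W ((u + φ) x) = 0 := by simp [hφ, hc1, hWa]
    rw [hc1] at hg
    unfold edens
    rw [hWv]
    have := hW0 (u x)
    change gradSq (u + φ) x ≤ _ at hg
    linarith
  have i2 : (∫ x in ball 0 (ρ + 1) \ ball 0 ρ, edens W (u + φ) x)
      ≤ ∫ x in ball 0 (ρ + 1) \ ball 0 ρ, ((1 + β) * edens W u x + α) := by
    refine setIntegral_mono_on ((cont_int_ball hev _).mono_set Set.sdiff_subset)
      ((cont_int_ball (by fun_prop) _).mono_set Set.sdiff_subset)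
      (measurableSet_ball.diff measurableSet_ball) fun x hx => ?_
    have hg := gradSq_cut u a (cutoff ρ) x (hud x) (hcd x) (L * 2)
      (by simpa using norm_fderiv_le_of_lipschitz ℝ (cutoff_lip hL ρ) (x₀ := x)) (cut0 x) (cut1 x)
    change gradSq (u + φ) x ≤ _ at hg
    have ht := hαβ x (cutoff ρ x ^ 2) ⟨by positivity, by nlinarith [cut0 x, cut1 x]⟩
    change _ + W ((u + φ) x) ≤ _ at ht
    have h1 := gradSq_nonneg u x
    have h2 := hW0 (u x)
    unfold edens
    nlinarith [mul_nonneg hβ h1, mul_nonneg (sq_nonneg (cutoff ρ x)) h1]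
  have i3 : ∫ x in ball 0 (ρ + 1) \ ball 0 ρ, ((1 + β) * edens W u x + α)
      = (1 + β) * ((∫ x in ball 0 (ρ + 1), edens W u x) - ∫ x in ball 0 ρ, edens W u x)
        + α * (Real.pi * (2 * ρ + 1)) := by
    rw [integral_add, integral_const_mul, s1 hec, setIntegral_const, ring_vol hρ.le, smul_eq_mul]
    · ring
    · exact ((cont_int_ball (continuous_const.mul hec) _).mono_set Set.sdiff_subset)
    · exact ((cont_int_ball continuous_const _).mono_set Set.sdiff_subset)
  rw [integral_const_mul] at i1
  have := s1 hev
  linarith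

lemma W_interp {m : ℕ}
    (W : EuclideanSpace ℝ (Fin m) → ℝ) (hW : Continuous W)
    (a : EuclideanSpace ℝ (Fin m))
    (hWa : W a = 0) (hWpos : ∀ v, v ≠ a → 0 < W v) (A M : ℝ) (hA : 0 ≤ A) :
    (∃ K, 0 ≤ K ∧ ∀ v, ‖v‖ ≤ M → ∀ t ∈ Set.Icc (0:ℝ) 1,
      A * ‖a - v‖ ^ 2 + W (v + t • (a - v)) ≤ K) ∧
    ∀ ε : ℝ, 0 < ε → ∃ C, 0 ≤ C ∧ ∀ v, ‖v‖ ≤ M → ∀ t ∈ Set.Icc (0:ℝ) 1,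
      A * ‖a - v‖ ^ 2 + W (v + t • (a - v)) ≤ ε + C * W v := by
  have hW0 : ∀ v, 0 ≤ W v := fun v => by
    by_cases h : v = a
    · rw [h, hWa]
    · exact (hWpos v h).le
  have h1 : ∃ K, 0 ≤ K ∧ ∀ v, ‖v‖ ≤ M → ∀ t ∈ Set.Icc (0:ℝ) 1,
      A * ‖a - v‖ ^ 2 + W (v + t • (a - v)) ≤ K := by
    obtain ⟨K, hK⟩ := ((isCompact_closedBall (0 : EuclideanSpace ℝ (Fin m)) M).prod
      (isCompact_Icc (a := (0:ℝ)) (b := 1))).exists_bound_of_continuousOn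
      (f := fun p : EuclideanSpace ℝ (Fin m) × ℝ =>
        A * ‖a - p.1‖ ^ 2 + W (p.1 + p.2 • (a - p.1))) (by fun_prop)
    refine ⟨max K 0, le_max_right _ _, fun v hv t ht => ?_⟩
    exact (le_abs_self _).trans ((hK (v, t) ⟨by simpa using hv, ht⟩).trans (le_max_left _ _))
  refine ⟨h1, fun ε hε => ?_⟩
  obtain ⟨K, hK0, hK⟩ := h1
  obtain ⟨r, hr, hrW⟩ := Metric.continuousAt_iff.1
    (show ContinuousAt (fun w => A * ‖a - w‖ ^ 2) a by fun_prop) (ε / 2) (by positivity)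
  obtain ⟨s, hs, hsW⟩ := Metric.continuousAt_iff.1 (hW.continuousAt (x := a)) (ε / 2) (by positivity)
  have hcomp : IsCompact (closedBall (0 : EuclideanSpace ℝ (Fin m)) M \ ball a (min r s)) :=
    (isCompact_closedBall _ _).diff isOpen_ball
  obtain ⟨w, hw, hwW⟩ := hcomp.exists_forall_le' hW.continuousOn (a := 0) (fun v hv => by
    apply hWpos
    rintro rfl
    exact hv.2 (mem_ball_self (lt_min hr hs)))
  refine ⟨K / w, by positivity, fun v hv t ht => ?_⟩
  by_cases hd : dist v a < min r s
  · have e1 := hrW (hd.trans_le (min_le_left _ _))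
    have e2 : dist (v + t • (a - v)) a < s := by
      have : v + t • (a - v) - a = (1 - t) • (v - a) := by
        simp only [smul_sub, sub_smul, one_smul]; abel
      rw [dist_eq_norm, this, norm_smul, Real.norm_of_nonneg (by linarith [ht.2]), ← dist_eq_norm]
      have := hd.trans_le (min_le_right r s)
      have := dist_nonneg (x := v) (y := a)
      nlinarith [ht.1]
    have e3 := hsW e2
    rw [hWa, Real.dist_eq, sub_zero] at e3
    rw [Real.dist_eq] at e1
    simp only [sub_self, norm_zero] at e1
    have e4 := (le_abs_self _).trans_lt e3
    have e5 := (le_abs_self _).trans_lt e1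
    have : 0 ≤ K / w * W v := mul_nonneg (by positivity) (hW0 v)
    nlinarith
  · have h2 := hwW v ⟨by simpa using hv, hd⟩
    have h3 := hK v hv t ht
    have : K ≤ K / w * W v := by
      rw [div_mul_eq_mul_div, le_div_iff₀ hw]
      exact mul_le_mul_of_nonneg_left h2 hK0
    linarith

lemma energy_littleO {m : ℕ}
    (W : EuclideanSpace ℝ (Fin m) → ℝ) (hW : Continuous W)
    (a : EuclideanSpace ℝ (Fin m))
    (hWa : W a = 0) (hWpos : ∀ v, v ≠ a → 0 < W v)
    (u : EuclideanSpace ℝ (Fin 2) → EuclideanSpace ℝ (Fin m))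
    (hu : ContDiff ℝ 2 u) (hbdd : ∃ C, ∀ x, ‖u x‖ ≤ C) (hmin : GloballyMinimizing W u)
    (ε : ℝ) (hε : 0 < ε) : ∃ R₀ : ℝ, 1 ≤ R₀ ∧ ∀ R : ℝ, R₀ ≤ R →
      ∫ x in ball 0 R, edens W u x ≤ ε * R := by
  have hW0 : ∀ v, 0 ≤ W v := fun v => by
    by_cases h : v = a
    · rw [h, hWa]
    · exact (hWpos v h).le
  obtain ⟨M, hM⟩ := hbdd
  obtain ⟨L, hL⟩ := exists_lip_smoothTransition
  obtain ⟨⟨K, hK0, hK⟩, hC⟩ := W_interp W hW a hWa hWpos (48 * (L:ℝ) ^ 2) M (by positivity)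
  set F : ℝ → ℝ := fun ρ => ∫ x in ball 0 ρ, edens W u x with hF
  have hpi := Real.pi_pos
  have ed0 : ∀ x, 0 ≤ edens W u x := fun x => by
    have := gradSq_nonneg u x
    have := hW0 (u x)
    unfold edens; positivity
  have hFmono : ∀ r s, r ≤ s → F r ≤ F s := fun r s hrs =>
    setIntegral_mono_set (cont_int_ball (edens_continuous W hW u hu) s)
      (Eventually.of_forall ed0) (Eventually.of_forall (ball_subset_ball hrs))
  have hF0 : ∀ r, 0 ≤ F r := fun r => integral_nonneg ed0
  have crude : ∀ ρ, 1 ≤ ρ → F ρ ≤ (6 * K * Real.pi) * ρ := by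
    intro ρ hρ
    have := basic_ineq W hW a hWa hW0 u hu hmin L hL K 0 le_rfl
      (fun x t ht => by simpa using hK (u x) (hM x) t ht) ρ (by linarith)
    change (1 / 2) * F ρ ≤ _ at this
    nlinarith [mul_nonneg hK0 hpi.le]
  obtain ⟨C, hC0, hCC⟩ := hC (ε / (24 * Real.pi)) (by positivity)
  have fine : ∀ ρ, 1 ≤ ρ → F ρ ≤ 2 * C * (F (ρ + 1) - F ρ) + ε / 4 * ρ := by
    intro ρ hρ
    have := basic_ineq W hW a hWa hW0 u hu hmin L hL (ε / (24 * Real.pi)) C hC0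
      (fun x t ht => hCC (u x) (hM x) t ht) ρ (by linarith)
    change (1 / 2) * F ρ ≤ C * (F (ρ + 1) - F ρ) + _ at this
    have e : ε / (24 * Real.pi) * (Real.pi * (2 * ρ + 1)) = ε / 24 * (2 * ρ + 1) := by
      field_simp
    rw [e] at this
    nlinarith
  have tele : ∀ R, 1 ≤ R → ∀ N : ℕ, (N : ℝ) ≤ R →
      N * F R ≤ 2 * C * (F (R + N) - F R) + N * (ε / 2 * R) := by
    intro R hR N
    induction N with
    | zero => intro _; simp
    | succ k ih =>
      intro hk
      push_cast at hk ⊢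
      have h1 := ih (by linarith)
      have hk0 : (0:ℝ) ≤ k := k.cast_nonneg
      have h2 := fine (R + k) (by linarith)
      have h3 := hFmono R (R + k) (by linarith)
      rw [show R + ((k:ℝ) + 1) = R + k + 1 by ring]
      nlinarith
  set D := 2 * C * (6 * K * Real.pi * 2) with hD
  have hD0 : 0 ≤ D := by positivity
  refine ⟨max 2 (4 * D / ε), le_max_of_le_left one_le_two, fun R hR => ?_⟩
  have hR2 : 2 ≤ R := (le_max_left _ _).trans hR
  have hRD : 4 * D ≤ R * ε := by
    rw [← div_le_iff₀ hε]; exact (le_max_right _ _).trans hR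
  change F R ≤ ε * R
  have hN1 : (⌊R⌋₊ : ℝ) ≤ R := Nat.floor_le (by linarith)
  have hN2 : R < ⌊R⌋₊ + 1 := Nat.lt_floor_add_one R
  set N := ⌊R⌋₊
  have h1 := tele R (by linarith) N hN1
  have h2 := crude (R + N) (by linarith)
  have h3 := hF0 R
  have h4 : 2 * C * (F (R + N) - F R) ≤ D * R := by
    have : F (R + N) - F R ≤ 6 * K * Real.pi * 2 * R := by
      nlinarith [mul_nonneg hK0 hpi.le]
    rw [hD, mul_assoc (2 * C)]
    exact mul_le_mul_of_nonneg_left this (by positivity)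
  have hNR : R / 2 ≤ N := by linarith
  have hNpos : (0:ℝ) < N := by linarith
  have h5 : N * F R ≤ N * (ε * R) := by
    have : D * R ≤ N * (ε / 2 * R) := by
      nlinarith [mul_nonneg (sub_nonneg.2 hNR) (mul_nonneg hε.le (by linarith : (0:ℝ) ≤ R)),
        mul_nonneg (sub_nonneg.2 hRD) (by linarith : (0:ℝ) ≤ R)]
    linarith
  exact le_of_mul_le_mul_left h5 hNpos

/-- circle parametrization -/
noncomputable def circ (S θ : ℝ) : EuclideanSpace ℝ (Fin 2) :=
  !₂[S * Real.cos θ, S * Real.sin θ]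

lemma circ_continuous : Continuous fun p : ℝ × ℝ => circ p.1 p.2 := by
  unfold circ
  refine (PiLp.continuous_toLp 2 _).comp (continuous_pi fun i => ?_)
  fin_cases i <;> simp <;> fun_prop

lemma circ_repr (p : ℝ × ℝ) :
    Complex.orthonormalBasisOneI.repr (Complex.polarCoord.symm p) = circ p.1 p.2 := by
  ext i
  rw [Complex.orthonormalBasisOneI_repr_apply, Complex.polarCoord_symm_apply, circ]
  fin_cases i <;> simp [Complex.cos_ofReal_re, Complex.sin_ofReal_re]

lemma circ_norm {S θ : ℝ} (hS : 0 ≤ S) : ‖circ S θ‖ = S := by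
  rw [EuclideanSpace.norm_eq, Fin.sum_univ_two]
  simp only [circ, PiLp.toLp_apply, Matrix.cons_val_zero, Matrix.cons_val_one, Real.norm_eq_abs, sq_abs]
  rw [show (S * Real.cos θ) ^ 2 + (S * Real.sin θ) ^ 2 = S ^ 2 by
    nlinarith [Real.sin_sq_add_cos_sq θ], Real.sqrt_sq hS]

lemma exists_circ (x : EuclideanSpace ℝ (Fin 2)) (S : ℝ) (hx : ‖x‖ = S) :
    ∃ θ ∈ Set.Icc (-Real.pi) Real.pi, circ S θ = x := by
  set z : ℂ := Complex.orthonormalBasisOneI.repr.symm x with hz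
  have hn : ‖z‖ = S := by rw [hz, LinearIsometryEquiv.norm_map, hx]
  refine ⟨z.arg, ⟨(Complex.neg_pi_lt_arg z).le, Complex.arg_le_pi z⟩, ?_⟩
  have h := circ_repr (S, z.arg)
  rw [← h, ← hn, Complex.polarCoord_symm_apply]
  simp only
  rw [Complex.ofReal_cos, Complex.ofReal_sin, Complex.norm_mul_cos_add_sin_mul_I, hz]
  exact LinearIsometryEquiv.apply_symm_apply _ x

lemma exists_good_circle (f : EuclideanSpace ℝ (Fin 2) → ℝ) (hf : Continuous f)
    (hf0 : ∀ x, 0 ≤ f x) (ε R : ℝ) (hR : 0 < R) (hε : 0 < ε)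
    (h : ∫ x in ball 0 (2 * R), f x ≤ ε * R) :
    ∃ S ∈ Set.Ioo R (2 * R), ∫ θ in (-Real.pi)..Real.pi, S * f (circ S θ) ≤ 2 * ε := by
  by_contra! hcon
  have hcc : ∀ S, Continuous fun θ => S * f (circ S θ) := fun S =>
    continuous_const.mul (hf.comp (circ_continuous.comp (by fun_prop : Continuous fun θ : ℝ => (S, θ))))
  have hlow : ∀ S ∈ Set.Ioo R (2 * R), ENNReal.ofReal (2 * ε) ≤
      ∫⁻ θ in Set.Ioo (-Real.pi) Real.pi, ENNReal.ofReal (S * f (circ S θ)) := by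
    intro S hS
    have h1 := hcon S hS
    rw [intervalIntegral.integral_of_le (by linarith [Real.pi_pos]), integral_Ioc_eq_integral_Ioo] at h1
    rw [← ofReal_integral_eq_lintegral_ofReal]
    · exact ENNReal.ofReal_le_ofReal h1.le
    · exact ((hcc S).continuousOn.integrableOn_compact isCompact_Icc).mono_set Set.Ioo_subset_Icc_self
    · exact Eventually.of_forall fun θ => mul_nonneg (hR.trans hS.1).le (hf0 _)
  set g : EuclideanSpace ℝ (Fin 2) → ENNReal :=
    (ball 0 (2 * R)).indicator (fun x => ENNReal.ofReal (f x)) with hg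
  have hgm : Measurable g := (hf.measurable.ennreal_ofReal).indicator measurableSet_ball
  have hup : ∫⁻ x, g x ≤ ENNReal.ofReal (ε * R) := by
    rw [hg, lintegral_indicator measurableSet_ball, ← ofReal_integral_eq_lintegral_ofReal
      (cont_int_ball hf _) (Eventually.of_forall hf0)]
    exact ENNReal.ofReal_le_ofReal h
  have e1 : ∫⁻ x, g x = ∫⁻ z : ℂ, g (Complex.orthonormalBasisOneI.repr z) :=
    ((Complex.orthonormalBasisOneI.repr.measurePreserving).lintegral_comp hgm).symm
  rw [e1, ← Complex.lintegral_comp_polarCoord_symm] at hup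
  simp only [circ_repr] at hup
  rw [polarCoord_target, Measure.volume_eq_prod, ← Measure.prod_restrict, lintegral_prod] at hup
  swap
  · refine Measurable.aemeasurable ?_
    have : Measurable fun p : ℝ × ℝ => circ p.1 p.2 := circ_continuous.measurable
    exact (measurable_fst.ennreal_ofReal).smul (hgm.comp this)
  have e2 : ∫⁻ S in Set.Ioo R (2 * R), ENNReal.ofReal (2 * ε) ≤ ENNReal.ofReal (ε * R) := by
    refine le_trans ?_ hup
    refine le_trans ?_ (lintegral_mono_set (s := Set.Ioo R (2 * R)) fun S hS => hR.trans hS.1)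
    refine setLIntegral_mono' measurableSet_Ioo fun S hS => ?_
    refine (hlow S hS).trans_eq ?_
    refine lintegral_congr fun θ => ?_
    have hS0 : 0 ≤ S := (hR.trans hS.1).le
    have : circ S θ ∈ ball 0 (2 * R) := by rw [mem_ball_zero_iff, circ_norm hS0]; exact hS.2
    rw [hg]
    simp only [Set.indicator_of_mem this, smul_eq_mul]
    rw [ENNReal.ofReal_mul hS0]
  rw [setLIntegral_const, Real.volume_Ioo, ← ENNReal.ofReal_mul (by positivity),
    ENNReal.ofReal_le_ofReal_iff (by positivity)] at e2
  nlinarith [mul_pos hε hR]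

lemma circ_hasDeriv {m : ℕ} (u : EuclideanSpace ℝ (Fin 2) → EuclideanSpace ℝ (Fin m))
    (hu : Differentiable ℝ u) (S : ℝ) (hS : 0 ≤ S) (θ : ℝ) :
    ∃ c', HasDerivAt (fun θ => u (circ S θ)) c' θ ∧ ‖c'‖ ^ 2 ≤ S ^ 2 * gradSq u (circ S θ) := by
  set e0 : EuclideanSpace ℝ (Fin 2) := EuclideanSpace.single 0 1
  set e1 : EuclideanSpace ℝ (Fin 2) := EuclideanSpace.single 1 1
  have hc : circ S = fun θ => (S * Real.cos θ) • e0 + (S * Real.sin θ) • e1 := by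
    ext θ i
    fin_cases i <;> simp [circ, e0, e1]
  have hd : HasDerivAt (circ S) ((S * (-Real.sin θ)) • e0 + (S * Real.cos θ) • e1) θ := by
    rw [hc]
    exact (((Real.hasDerivAt_cos θ).const_mul S).smul_const e0).add
      (((Real.hasDerivAt_sin θ).const_mul S).smul_const e1)
  refine ⟨_, (hu (circ S θ)).hasFDerivAt.comp_hasDerivAt θ hd, ?_⟩
  rw [map_add, map_smul, map_smul]
  unfold gradSq
  rw [Fin.sum_univ_two]
  change _ ≤ S ^ 2 * (‖fderiv ℝ u (circ S θ) e0‖ ^ 2 + ‖fderiv ℝ u (circ S θ) e1‖ ^ 2)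
  set A := fderiv ℝ u (circ S θ) e0
  set B := fderiv ℝ u (circ S θ) e1
  have hn : ‖(S * -Real.sin θ) • A + (S * Real.cos θ) • B‖
      ≤ S * (|Real.sin θ| * ‖A‖ + |Real.cos θ| * ‖B‖) := by
    refine (norm_add_le _ _).trans ?_
    rw [norm_smul, norm_smul]
    simp only [norm_mul, norm_neg, Real.norm_eq_abs, abs_of_nonneg hS]
    apply le_of_eq; ring
  have hsc : |Real.sin θ| ^ 2 + |Real.cos θ| ^ 2 = 1 := by
    rw [sq_abs, sq_abs]; exact Real.sin_sq_add_cos_sq θ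
  calc _ ≤ (S * (|Real.sin θ| * ‖A‖ + |Real.cos θ| * ‖B‖)) ^ 2 := by gcongr
    _ = S ^ 2 * (|Real.sin θ| * ‖A‖ + |Real.cos θ| * ‖B‖) ^ 2 := by ring
    _ ≤ S ^ 2 * (‖A‖ ^ 2 + ‖B‖ ^ 2) := by
      gcongr
      have : (|Real.sin θ| * ‖A‖ + |Real.cos θ| * ‖B‖) ^ 2 +
        (|Real.cos θ| * ‖A‖ - |Real.sin θ| * ‖B‖) ^ 2 =
         (|Real.sin θ| ^ 2 + |Real.cos θ| ^ 2) * (‖A‖ ^ 2 + ‖B‖ ^ 2) := by ring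
      rw [hsc, one_mul] at this
      nlinarith [sq_nonneg (|Real.cos θ| * ‖A‖ - |Real.sin θ| * ‖B‖)]

/-- Estimate (2.17): for `n = 2`, a bounded globally minimizing solution is uniformly
close to `a` on suitable circles `|x| = S_R` with `S_R ∈ (R, 2R)`, for all large `R`. -/
theorem small_on_good_circles
    (m : ℕ) (hm : 1 ≤ m)
    (W : EuclideanSpace ℝ (Fin m) → ℝ) (hW : ContDiff ℝ 1 W)
    (a : EuclideanSpace ℝ (Fin m))
    (hWa : W a = 0) (hWpos : ∀ v, v ≠ a → 0 < W v)
    (u : EuclideanSpace ℝ (Fin 2) → EuclideanSpace ℝ (Fin m))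
    (hu : ContDiff ℝ 2 u)
    (hbdd : ∃ C, ∀ x, ‖u x‖ ≤ C)
    (hsol : ∀ x, vlap u x = gradient W (u x))
    (hmin : GloballyMinimizing W u) :
    ∀ δ : ℝ, 0 < δ → ∃ R₀ : ℝ, 1 ≤ R₀ ∧ ∀ R : ℝ, R₀ ≤ R →
      ∃ S ∈ Set.Ioo R (2 * R),
        ∀ x : EuclideanSpace ℝ (Fin 2), ‖x‖ = S → ‖u x - a‖ ≤ δ := by
  intro δ hδ
  have hWc : Continuous W := hW.continuous
  have hW0 : ∀ v, 0 ≤ W v := fun v => by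
    by_cases h : v = a
    · rw [h, hWa]
    · exact (hWpos v h).le
  have hbdd' := hbdd
  obtain ⟨M, hM⟩ := hbdd'
  have hcomp : IsCompact (closedBall (0 : EuclideanSpace ℝ (Fin m)) M \ ball a (δ / 2)) :=
    (isCompact_closedBall _ _).diff isOpen_ball
  obtain ⟨w, hw, hwW⟩ := hcomp.exists_forall_le' hWc.continuousOn (a := 0) (fun v hv => by
    apply hWpos
    rintro rfl
    exact hv.2 (mem_ball_self (by positivity)))
  set ε := min (δ ^ 2 / 16) (w / 2) with hεd
  have hε : 0 < ε := by positivity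
  have hε1 : ε ≤ δ ^ 2 / 16 := min_le_left _ _
  have hε2 : ε ≤ w / 2 := min_le_right _ _
  obtain ⟨R₀, hR₀, hE⟩ := energy_littleO W hWc a hWa hWpos u hu hbdd hmin (ε / 4) (by positivity)
  refine ⟨R₀, hR₀, fun R hR => ?_⟩
  have hec := edens_continuous W hWc u hu
  have ed0 : ∀ x, 0 ≤ edens W u x := fun x => by
    have := gradSq_nonneg u x
    have := hW0 (u x)
    unfold edens; positivity
  obtain ⟨S, hS, hSI⟩ := exists_good_circle (edens W u) hec ed0 (ε / 2) R (by linarith)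
    (by positivity) (by have := hE (2 * R) (by linarith); linarith)
  refine ⟨S, hS, fun x hx => ?_⟩
  obtain ⟨θ₀, hθ₀, rfl⟩ := exists_circ x S hx
  have hS1 : 1 ≤ S := by linarith [hS.1]
  have hS0 : 0 < S := by linarith
  have hpi := Real.pi_gt_three
  have hSinv : 1 / S ≤ 1 := by rw [div_le_one hS0]; exact hS1
  have hSinv0 : 0 < 1 / S := by positivity
  obtain ⟨p, q, hp, hq, hpq, hpθ, hqθ⟩ : ∃ p q : ℝ, -Real.pi ≤ p ∧ q ≤ Real.pi ∧ q - p = 1 / S ∧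
      p ≤ θ₀ ∧ θ₀ ≤ q := by
    by_cases h : θ₀ ≤ 0
    · exact ⟨θ₀, θ₀ + 1 / S, hθ₀.1, by linarith, by ring, le_rfl, by linarith⟩
    · exact ⟨θ₀ - 1 / S, θ₀, by linarith, hθ₀.2, by ring, by linarith, le_rfl⟩
  have hple : p ≤ q := by linarith
  have hcc : Continuous fun θ => S * edens W u (circ S θ) :=
    continuous_const.mul (hec.comp (circ_continuous.comp
      (by fun_prop : Continuous fun θ : ℝ => (S, θ))))
  have hI : ∫ θ in p..q, S * edens W u (circ S θ) ≤ ε := by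
    refine le_trans (intervalIntegral.integral_mono_interval hp hple hq
      (Eventually.of_forall fun θ => mul_nonneg hS0.le (ed0 _)) (hcc.intervalIntegrable _ _)) ?_
    linarith
  by_contra! hcon
  by_cases hall : ∀ θ ∈ Set.Icc p q, δ / 2 ≤ ‖u (circ S θ) - a‖
  · have h1 : ∫ θ in p..q, S * w ≤ ∫ θ in p..q, S * edens W u (circ S θ) := by
      refine intervalIntegral.integral_mono_on hple (by simp) (hcc.intervalIntegrable _ _)
        fun θ hθ => ?_
      refine mul_le_mul_of_nonneg_left ?_ hS0.le
      have h2 := hwW (u (circ S θ)) ⟨by simpa using hM _, by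
        rw [mem_ball, dist_eq_norm, not_lt]; exact hall θ hθ⟩
      have := gradSq_nonneg u (circ S θ)
      unfold edens; linarith
    rw [intervalIntegral.integral_const, hpq, smul_eq_mul] at h1
    have : 1 / S * (S * w) = w := by field_simp
    linarith
  · push Not at hall
    obtain ⟨θ₁, hθ₁, hlt⟩ := hall
    have hud : Differentiable ℝ u := hu.differentiable (by norm_num)
    choose c' hc' hcn using circ_hasDeriv u hud S hS0.le
    have hcont : Continuous c' := by
      have hcirc : ContDiff ℝ 1 (circ S) := by
        unfold circ
        refine (PiLp.contDiff_toLp (𝕜 := ℝ)).comp (contDiff_pi.2 fun i => ?_)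
        fin_cases i
        · exact contDiff_const.mul Real.contDiff_cos
        · exact contDiff_const.mul Real.contDiff_sin
      have h1 : ContDiff ℝ 1 fun θ => u (circ S θ) := (hu.of_le (by norm_num)).comp hcirc
      have h2 : c' = deriv fun θ => u (circ S θ) := funext fun θ => (hc' θ).deriv.symm
      rw [h2]
      exact h1.continuous_deriv le_rfl
    have hftc := intervalIntegral.integral_eq_sub_of_hasDerivAt (a := θ₁) (b := θ₀)
      (fun θ _ => hc' θ) (hcont.intervalIntegrable _ _)
    have hn : ‖u (circ S θ₀) - u (circ S θ₁)‖ ≤ ∫ θ in p..q, ‖c' θ‖ := by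
      rw [← hftc, intervalIntegral.integral_of_le hple]
      refine (intervalIntegral.norm_integral_le_integral_norm_uIoc).trans ?_
      refine setIntegral_mono_set ?_ (Eventually.of_forall fun θ => norm_nonneg _)
        (Eventually.of_forall ?_)
      · exact (hcont.norm.continuousOn.integrableOn_compact isCompact_Icc).mono_set
          Set.Ioc_subset_Icc_self
      · exact Set.Ioc_subset_Ioc (le_min hθ₁.1 hpθ) (max_le hθ₁.2 hqθ)
    have hb : ∫ θ in p..q, ‖c' θ‖ ≤
        ∫ θ in p..q, (S * (δ / 4) + 2 / δ * (S * edens W u (circ S θ))) := by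
      refine intervalIntegral.integral_mono_on hple (hcont.norm.intervalIntegrable _ _)
        (Continuous.intervalIntegrable (by fun_prop) _ _) fun θ _ => ?_
      have h1 := hcn θ
      have h2 := hW0 (u (circ S θ))
      have h3 : gradSq u (circ S θ) ≤ 2 * edens W u (circ S θ) := by unfold edens; linarith
      have h4 : ‖c' θ‖ ^ 2 ≤ S ^ 2 * (2 * edens W u (circ S θ)) :=
        h1.trans (mul_le_mul_of_nonneg_left h3 (by positivity))
      have h5 : S * δ * ‖c' θ‖ ≤
          S * δ * (S * (δ / 4) + 2 / δ * (S * edens W u (circ S θ))) := by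
        have : S * δ * (S * (δ / 4) + 2 / δ * (S * edens W u (circ S θ)))
            = (S * (δ / 2)) ^ 2 + S ^ 2 * (2 * edens W u (circ S θ)) := by
          field_simp
          ring
        rw [this]
        nlinarith [sq_nonneg (S * (δ / 2) - ‖c' θ‖)]
      exact le_of_mul_le_mul_left h5 (by positivity)
    rw [intervalIntegral.integral_add (by simp) (Continuous.intervalIntegrable (by fun_prop) _ _),
      intervalIntegral.integral_const, intervalIntegral.integral_const_mul, hpq, smul_eq_mul] at hb
    have e1 : 1 / S * (S * (δ / 4)) = δ / 4 := by field_simp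
    have e2 : 2 / δ * (∫ θ in p..q, S * edens W u (circ S θ)) ≤ δ / 8 := by
      calc _ ≤ 2 / δ * (δ ^ 2 / 16) :=
            mul_le_mul_of_nonneg_left (hI.trans hε1) (by positivity)
        _ = δ / 8 := by field_simp; norm_num
    have e3 := norm_sub_le_norm_sub_add_norm_sub (u (circ S θ₀)) (u (circ S θ₁)) a
    linarith
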